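/- Fix a natural number k ≥ 1. If every countable graph that admits both a k-packing and a k-covering admits a k-decomposition, then every graph (of arbitrary cardinality) that admits both a k-packing and a k-covering admits a k-decomposition. -/

import Mathlib

universe u
open Cardinal

/-- `T` is a spanning tree of `G`: a connected, acyclic subgraph of `G`
containing all vertices of `G` (as `T` lives on the same vertex type `V`,
connectedness of `T` already makes it spanning). -/
def IsSpanningTree {V : Type u} (G T : SimpleGraph V) : Prop :=
  T ≤ G ∧ T.IsTree

/-- A `k`-packing of `G`: a family of `k` pairwise edge-disjoint spanning trees. -/
def HasPackingN {V : Type u} (G : SimpleGraph V) (k : ℕ) : Prop :=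
  ∃ T : Fin k → SimpleGraph V,
    (∀ i, IsSpanningTree G (T i)) ∧
    Pairwise (fun i j => Disjoint (T i).edgeSet (T j).edgeSet)

/-- A `k`-covering of `G`: a family of `k` spanning trees whose edge sets cover the
edge set of `G`. -/
def HasCoveringN {V : Type u} (G : SimpleGraph V) (k : ℕ) : Prop :=
  ∃ T : Fin k → SimpleGraph V,
    (∀ i, IsSpanningTree G (T i)) ∧
    (⋃ i, (T i).edgeSet) = G.edgeSet

/-- A `k`-decomposition of `G`: a family of `k` spanning trees whose edge sets
partition the edge set of `G`. -/
def HasDecompositionN {V : Type u} (G : SimpleGraph V) (k : ℕ) : Prop :=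
  ∃ T : Fin k → SimpleGraph V,
    (∀ i, IsSpanningTree G (T i)) ∧
    (Pairwise (fun i j => Disjoint (T i).edgeSet (T j).edgeSet)) ∧
    (⋃ i, (T i).edgeSet) = G.edgeSet

namespace SimpleGraph

/-- The part of `A` with both ends in `U`, as a graph on the same vertex type. -/
def within {X : Type*} (A : SimpleGraph X) (U : Set X) : SimpleGraph X where
  Adj a b := A.Adj a b ∧ a ∈ U ∧ b ∈ U
  symm := ⟨fun _ _ h => ⟨h.1.symm, h.2.2, h.2.1⟩⟩
  loopless := ⟨fun _ h => h.1.ne rfl⟩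

lemma within_le {X : Type*} (A : SimpleGraph X) (U : Set X) : A.within U ≤ A :=
  fun _ _ h => h.1

/-- `A` is, up to isolated vertices outside of `U`, a tree with vertex set `U`. -/
structure IsTreeOn {X : Type*} (A : SimpleGraph X) (U : Set X) : Prop where
  mem_of_adj : ∀ a b, A.Adj a b → a ∈ U
  isAcyclic : A.IsAcyclic
  reachable : ∀ a ∈ U, ∀ b ∈ U, A.Reachable a b

lemma Reachable.lift_of_adj {X Y : Type*} {A : SimpleGraph X} {B : SimpleGraph Y} (f : X → Y)
    (hf : ∀ a b, A.Adj a b → B.Reachable (f a) (f b)) {a b : X} (h : A.Reachable a b) :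
    B.Reachable (f a) (f b) := by
  obtain ⟨w⟩ := h
  induction w with
  | nil => rfl
  | cons h _ ih => exact (hf _ _ h).trans ih

lemma IsAcyclic.not_reachable_of_adj {X : Type*} {A : SimpleGraph X} (hA : A.IsAcyclic) {a b : X}
    (h : A.Adj a b) : ¬ (A.deleteEdges {s(a, b)}).Reachable a b :=
  isBridge_iff.1 (isAcyclic_iff_forall_adj_isBridge.1 hA h)

lemma IsAcyclic.eq_of_adj_of_adj {X : Type*} {A : SimpleGraph X} (hA : A.IsAcyclic) {P : Set X}
    (hP : ∀ p ∈ P, ∀ q ∈ P, (A.within P).Reachable p q) {d p q : X} (hd : d ∉ P)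
    (hp : p ∈ P) (hq : q ∈ P) (hdp : A.Adj d p) (hdq : A.Adj d q) : p = q := by
  by_contra hne
  apply hA.not_reachable_of_adj hdp
  have h1 : (A.deleteEdges {s(d, p)}).Adj d q := by
    simp [deleteEdges_adj, hdq, Ne.symm hne]
    grind
  refine h1.reachable.trans ((hP q hq p hp).mono ?_)
  intro x y h
  have := h.2
  simp [deleteEdges_adj, h.1]
  grind

/-- Acyclic graphs that cover the edges of a complete graph with the right number
of vertices are connected. -/
lemma connected_of_isAcyclic_of_cover_top {N : Type*} [Fintype N] {k : ℕ}
    (hk : 1 ≤ k) (hN : Fintype.card N = 2 * k) (F : Fin k → SimpleGraph N)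
    (hF : ∀ i, (F i).IsAcyclic) (hcov : ∀ a b, a ≠ b → ∃ i, (F i).Adj a b) (i : Fin k) :
    (F i).Connected := by
  classical
  have : Nonempty N := Fintype.card_pos_iff.1 (by omega)
  choose T hFT hTT hT using fun i =>
    (connected_top (V := N)).exists_isTree_le_of_le_of_isAcyclic (le_top (a := F i)) (hF i)
  have h1 : ∀ i, (F i).edgeFinset.card ≤ (T i).edgeFinset.card := fun i =>
    Finset.card_le_card (edgeFinset_mono (hFT i))
  have h2 : ∀ i, (T i).edgeFinset.card = 2 * k - 1 := fun i => by
    have := (hT i).card_edgeFinset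
    omega
  have h3 : (⊤ : SimpleGraph N).edgeFinset.card ≤ ∑ i, (F i).edgeFinset.card := by
    refine (Finset.card_le_card (t := Finset.univ.biUnion fun i => (F i).edgeFinset) ?_).trans
      Finset.card_biUnion_le
    intro e
    induction e with | h a b => simpa using hcov a b
  have h4 : (⊤ : SimpleGraph N).edgeFinset.card = ∑ i, (T i).edgeFinset.card := by
    rw [card_edgeFinset_top_eq_card_choose_two, hN, Nat.choose_two_right]
    simp [h2, mul_assoc]
  have h5 := (Finset.sum_eq_sum_iff_of_le fun i _ => h1 i).1
    (le_antisymm (Finset.sum_le_sum fun i _ => h1 i) (h4 ▸ h3)) i (Finset.mem_univ i)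
  have h6 := Finset.eq_of_subset_of_card_le (edgeFinset_mono (hFT i)) h5.ge
  rw [edgeFinset_inj.1 h6]
  exact (hT i).connected

/-- Connected edge-disjoint graphs on the right number of vertices are trees. -/
lemma isTree_of_connected_of_disjoint {N : Type*} [Fintype N] {k : ℕ}
    (hN : Fintype.card N = 2 * k) (F : Fin k → SimpleGraph N)
    (hF : ∀ i, (F i).Connected)
    (hdisj : ∀ i j a b, (F i).Adj a b → (F j).Adj a b → i = j) (i : Fin k) :
    (F i).IsTree := by
  classical
  have h1 : ∀ i, 2 * k - 1 ≤ (F i).edgeFinset.card := fun i => by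
    have := (hF i).card_vert_le_card_edgeSet_add_one
    simp only [Nat.card_eq_fintype_card, ← edgeFinset_card, hN] at this
    omega
  have h3 : ∑ i, (F i).edgeFinset.card ≤ (⊤ : SimpleGraph N).edgeFinset.card := by
    rw [← Finset.card_biUnion]
    · refine Finset.card_le_card ?_
      intro e
      induction e with | h a b => simpa using fun i h => h.ne
    · intro i _ j _ hij
      rw [Function.onFun, Finset.disjoint_left]
      intro e
      induction e with | h a b => simpa using fun h h' => hij (hdisj i j a b h h')
  have h4 : (⊤ : SimpleGraph N).edgeFinset.card = ∑ _i : Fin k, (2 * k - 1) := by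
    rw [card_edgeFinset_top_eq_card_choose_two, hN, Nat.choose_two_right]
    simp [mul_assoc]
  have h5 := (Finset.sum_eq_sum_iff_of_le fun i _ => h1 i).1
    (le_antisymm (Finset.sum_le_sum fun i _ => h1 i) (h4 ▸ h3)) i (Finset.mem_univ i)
  rw [isTree_iff_connected_and_card]
  refine ⟨hF i, ?_⟩
  have := i.pos
  simp only [Nat.card_eq_fintype_card, ← edgeFinset_card, hN]
  omega

/-- The colour of an edge in the decomposition of `K_{2k}` into `k` double stars, the `i`-th
of which has the centres `(i, false)` and `(i, true)`. -/
def doubleStarColor {k : ℕ} (x y : Fin k × Bool) : Fin k :=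
  if x.2 = y.2 then min x.1 y.1 else max x.1 y.1

/-- The `i`-th double star in the decomposition of `K_{2k}`. -/
def doubleStar {k : ℕ} (i : Fin k) : SimpleGraph (Fin k × Bool) where
  Adj x y := x ≠ y ∧ doubleStarColor x y = i
  symm := ⟨fun x y h => ⟨h.1.symm, by
    simpa only [doubleStarColor, min_comm, max_comm, eq_comm (a := y.2)] using h.2⟩⟩
  loopless := ⟨fun _ h => h.1 rfl⟩

lemma doubleStar_connected {k : ℕ} (i : Fin k) : (doubleStar i).Connected := by
  have : Nonempty (Fin k × Bool) := ⟨(i, true)⟩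
  have hc : (doubleStar i).Reachable (i, false) (i, true) :=
    Adj.reachable ⟨by simp, by simp [doubleStarColor]⟩
  have hcs : ∀ s, (doubleStar i).Reachable (i, true) (i, s) := by
    rintro (_ | _)
    · exact hc.symm
    · rfl
  have h : ∀ x, (doubleStar i).Reachable (i, true) x := by
    rintro ⟨j, s⟩
    rcases lt_trichotomy j i with h | rfl | h
    · exact (hcs !s).trans (Adj.reachable ⟨by simp [h.ne'], by simp [doubleStarColor, h.le]⟩)
    · exact hcs s
    · exact (hcs s).trans (Adj.reachable ⟨by simp [h.ne], by simp [doubleStarColor, h.le]⟩)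
  exact ⟨fun x y => (h x).symm.trans (h y)⟩

lemma doubleStar_isTree {k : ℕ} (i : Fin k) : (doubleStar i).IsTree :=
  isTree_of_connected_of_disjoint (by simp [mul_comm]) doubleStar doubleStar_connected
    (fun _ _ _ _ h h' => h.2.symm.trans h'.2) i

/-- Two graphs that agree outside of `P` and `Q`, and after contracting `P` and `Q`: if one is
a tree and `P`, `Q` span subtrees, then the other one is a tree as well. -/
lemma IsTreeOn.transfer {X Y D : Type*} {A : SimpleGraph X} {B : SimpleGraph Y} {P : Set X}
    {Q : Set Y} {f : D → X} {g : D → Y} (hf : f.Injective) (hg : g.Injective)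
    (hfP : ∀ d, f d ∉ P) (hgQ : ∀ d, g d ∉ Q) {p₀ : X} (hp₀ : p₀ ∈ P) {q₀ : Y} (hq₀ : q₀ ∈ Q)
    (hA : A.IsTreeOn (P ∪ Set.range f))
    (hAP : ∀ p ∈ P, ∀ q ∈ P, (A.within P).Reachable p q)
    (hB : ∀ a b, B.Adj a b → a ∈ Q ∪ Set.range g) (hBQ : (B.within Q).IsTreeOn Q)
    (hD : ∀ d d', A.Adj (f d) (f d') ↔ B.Adj (g d) (g d'))
    (hPQ : ∀ d, (∃ p ∈ P, A.Adj (f d) p) ↔ ∃ q ∈ Q, B.Adj (g d) q)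
    (huniq : ∀ d, ∀ q ∈ Q, ∀ q' ∈ Q, B.Adj (g d) q → B.Adj (g d) q' → q = q') :
    B.IsTreeOn (Q ∪ Set.range g) := by
  classical
  refine ⟨hB, ?_, ?_⟩
  · -- every edge with an end in the range of `g` is a bridge
    have key : ∀ d y x, B.Adj (g d) y → A.Adj (f d) x →
        ((x ∈ P ∧ y ∈ Q) ∨ ∃ d', x = f d' ∧ y = g d') → B.IsBridge s(g d, y) := by
      intro d y x hy hx hxy
      rw [isBridge_iff]
      intro hr
      set A' := A.deleteEdges {s(f d, x)} with hA'
      have hPr : ∀ p ∈ P, ∀ q ∈ P, A'.Reachable p q := fun p hp q hq =>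
        (hAP p hp q hq).mono fun a b hab => by
          refine deleteEdges_adj.2 ⟨hab.1, fun h => ?_⟩
          have h1 := hab.2
          have h2 := hfP d
          rcases Sym2.eq_iff.1 h with ⟨rfl, rfl⟩ | ⟨rfl, rfl⟩
          · exact h2 h1.1
          · exact h2 h1.2
      let ψ : Y → X := Function.extend g f fun _ => p₀
      have ψg : ∀ d, ψ (g d) = f d := fun d => hg.extend_apply _ _ d
      have ψQ : ∀ q ∈ Q, ψ q = p₀ := fun q hq =>
        Function.extend_apply' _ _ _ (by rintro ⟨d, rfl⟩; exact hgQ d hq)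
      have hgq : ∀ d₁, ∀ q ∈ Q, (B.deleteEdges {s(g d, y)}).Adj (g d₁) q →
          A'.Reachable (f d₁) p₀ := by
        intro d₁ q hq h
        obtain ⟨hdq, hne⟩ := deleteEdges_adj.1 h
        obtain ⟨p, hp, hadj⟩ := (hPQ d₁).2 ⟨q, hq, hdq⟩
        refine (Adj.reachable (deleteEdges_adj.2 ⟨hadj, fun he => ?_⟩)).trans (hPr p hp p₀ hp₀)
        rcases Sym2.eq_iff.1 he with ⟨h1, h2⟩ | ⟨h1, h2⟩
        · obtain rfl := hf h1
          subst h2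
          rcases hxy with ⟨_, hyQ⟩ | ⟨d', rfl, _⟩
          · exact hne (by rw [huniq _ _ hq _ hyQ hdq hy]; rfl)
          · exact hfP _ hp
        · exact hfP d (h2 ▸ hp)
      have hmap : ∀ a b, (B.deleteEdges {s(g d, y)}).Adj a b → A'.Reachable (ψ a) (ψ b) := by
        intro a b hab
        have hab' := deleteEdges_adj.1 hab
        rcases hB a b hab'.1 with ha | ⟨d₁, rfl⟩ <;> rcases hB b _ hab'.1.symm with hb | ⟨d₂, rfl⟩
        · rw [ψQ a ha, ψQ b hb]
        · rw [ψg, ψQ a ha]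
          exact (hgq d₂ a ha hab.symm).symm
        · rw [ψg, ψQ b hb]
          exact hgq d₁ b hb hab
        · rw [ψg, ψg]
          refine Adj.reachable (deleteEdges_adj.2 ⟨(hD _ _).2 hab'.1, fun he => hab'.2 ?_⟩)
          rcases hxy with ⟨hxP, _⟩ | ⟨d', rfl, rfl⟩
          · rcases Sym2.eq_iff.1 he with ⟨_, h2⟩ | ⟨h1, _⟩
            · exact absurd hxP (h2 ▸ hfP d₂)
            · exact absurd hxP (h1 ▸ hfP d₁)
          · rcases Sym2.eq_iff.1 he with ⟨h1, h2⟩ | ⟨h1, h2⟩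
            · rw [hf h1, hf h2]; rfl
            · rw [hf h1, hf h2, Sym2.eq_swap]; rfl
      have h1 := hr.lift_of_adj ψ hmap
      rw [ψg] at h1
      refine hA.isAcyclic.not_reachable_of_adj hx (h1.trans ?_)
      rcases hxy with ⟨hxP, hyQ⟩ | ⟨d', rfl, rfl⟩
      · rw [ψQ y hyQ]
        exact hPr _ hp₀ _ hxP
      · rw [ψg]
    have key' : ∀ d y, B.Adj (g d) y → B.IsBridge s(g d, y) := by
      intro d y h
      rcases hB _ _ h.symm with hy | ⟨d', rfl⟩
      · obtain ⟨p, hp, hadj⟩ := (hPQ d).2 ⟨y, hy, h⟩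
        exact key d y p h hadj (Or.inl ⟨hp, hy⟩)
      · exact key d _ (f d') h ((hD _ _).2 h) (Or.inr ⟨d', rfl, rfl⟩)
    rw [isAcyclic_iff_forall_adj_isBridge]
    intro x y hxy
    rcases hB _ _ hxy with hx | ⟨d, rfl⟩
    swap
    · exact key' d y hxy
    rcases hB _ _ hxy.symm with hy | ⟨d, rfl⟩
    swap
    · rw [Sym2.eq_swap]
      exact key' d x hxy.symm
    -- edges inside `Q`: retract everything onto `Q`
    rw [isBridge_iff]
    intro hr
    have : Nonempty Y := ⟨q₀⟩
    let cand : D → Y → Prop := fun d q =>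
      q ∈ Q ∧ ∃ d', (A.within (Set.range f)).Reachable (f d) (f d') ∧ B.Adj (g d') q
    have hcand : ∀ d q q', cand d q → cand d q' → q = q' := by
      rintro d q q' ⟨hq, d₁, hr₁, h₁⟩ ⟨hq', d₂, hr₂, h₂⟩
      obtain ⟨p₁, hp₁, ha₁⟩ := (hPQ d₁).2 ⟨q, hq, h₁⟩
      obtain ⟨p₂, hp₂, ha₂⟩ := (hPQ d₂).2 ⟨q', hq', h₂⟩
      by_cases hd : d₁ = d₂
      · subst hd
        exact huniq _ _ hq _ hq' h₁ h₂
      exfalso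
      apply hA.isAcyclic.not_reachable_of_adj ha₁
      have hs₁ : (A.deleteEdges {s(f d₁, p₁)}).Reachable (f d₁) (f d₂) := by
        refine (hr₁.symm.trans hr₂).mono ?_
        intro a b hab
        refine deleteEdges_adj.2 ⟨hab.1, fun he => ?_⟩
        obtain ⟨_, ⟨d₃, rfl⟩, ⟨d₄, rfl⟩⟩ := hab
        rcases Sym2.eq_iff.1 he with ⟨_, h⟩ | ⟨h, _⟩
        · exact hfP _ (h ▸ hp₁)
        · exact hfP _ (h ▸ hp₁)
      have hs₂ : (A.deleteEdges {s(f d₁, p₁)}).Adj (f d₂) p₂ := by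
        refine deleteEdges_adj.2 ⟨ha₂, fun he => ?_⟩
        rcases Sym2.eq_iff.1 he with ⟨h, _⟩ | ⟨h, _⟩
        · exact hd (hf h).symm
        · exact hfP _ (h ▸ hp₁)
      refine (hs₁.trans hs₂.reachable).trans ((hAP p₂ hp₂ p₁ hp₁).mono ?_)
      intro a b hab
      refine deleteEdges_adj.2 ⟨hab.1, fun he => ?_⟩
      rcases Sym2.eq_iff.1 he with ⟨h, _⟩ | ⟨_, h⟩
      · exact hfP _ (h ▸ hab.2.1)
      · exact hfP _ (h ▸ hab.2.2)
    let ρ : Y → Y := Function.extend g (fun d => Classical.epsilon (cand d)) id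
    have ρg : ∀ d, ρ (g d) = Classical.epsilon (cand d) := fun d => hg.extend_apply _ _ d
    have ρQ : ∀ q ∈ Q, ρ q = q := fun q hq =>
      Function.extend_apply' _ _ _ (by rintro ⟨d, rfl⟩; exact hgQ d hq)
    have ρgq : ∀ d, ∀ q ∈ Q, B.Adj (g d) q → ρ (g d) = q := fun d q hq h => by
      have hc : cand d q := ⟨hq, d, Reachable.refl _, h⟩
      rw [ρg]
      exact hcand _ _ _ (Classical.epsilon_spec ⟨q, hc⟩) hc
    have h1 := hr.lift_of_adj (B := (B.within Q).deleteEdges {s(x, y)}) ρ (by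
      intro a b hab
      have hab' := deleteEdges_adj.1 hab
      rcases hB a b hab'.1 with ha | ⟨d₁, rfl⟩ <;> rcases hB b _ hab'.1.symm with hb | ⟨d₂, rfl⟩
      · rw [ρQ a ha, ρQ b hb]
        exact Adj.reachable (deleteEdges_adj.2 ⟨⟨hab'.1, ha, hb⟩, hab'.2⟩)
      · rw [ρQ a ha, ρgq d₂ a ha hab'.1.symm]
      · rw [ρQ b hb, ρgq d₁ b hb hab'.1]
      · have hadj : (A.within (Set.range f)).Adj (f d₁) (f d₂) :=
          ⟨(hD _ _).2 hab'.1, ⟨d₁, rfl⟩, ⟨d₂, rfl⟩⟩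
        have : cand d₁ = cand d₂ := by
          funext q
          refine propext (and_congr_right fun _ => exists_congr fun d' => and_congr_left fun _ => ?_)
          exact ⟨hadj.symm.reachable.trans, hadj.reachable.trans⟩
        rw [ρg, ρg, this])
    rw [ρQ x hx, ρQ y hy] at h1
    exact hBQ.isAcyclic.not_reachable_of_adj ⟨hxy, hx, hy⟩ h1
  · have hQr : ∀ p ∈ Q, ∀ q ∈ Q, B.Reachable p q := fun p hp q hq =>
      (hBQ.reachable p hp q hq).mono (within_le _ _)
    let φ : X → Y := Function.extend f g fun _ => q₀
    have φf : ∀ d, φ (f d) = g d := fun d => hf.extend_apply _ _ d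
    have φP : ∀ p ∈ P, φ p = q₀ := fun p hp =>
      Function.extend_apply' _ _ _ (by rintro ⟨d, rfl⟩; exact hfP d hp)
    have hfp : ∀ d, ∀ p ∈ P, A.Adj (f d) p → B.Reachable (g d) q₀ := by
      intro d p hp h
      obtain ⟨q, hq, hadj⟩ := (hPQ d).1 ⟨p, hp, h⟩
      exact hadj.reachable.trans (hQr q hq q₀ hq₀)
    have hmap : ∀ a b, A.Adj a b → B.Reachable (φ a) (φ b) := by
      intro a b hab
      rcases hA.mem_of_adj a b hab with ha | ⟨d₁, rfl⟩ <;>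
        rcases hA.mem_of_adj b _ hab.symm with hb | ⟨d₂, rfl⟩
      · rw [φP a ha, φP b hb]
      · rw [φf, φP a ha]
        exact (hfp d₂ a ha hab.symm).symm
      · rw [φf, φP b hb]
        exact hfp d₁ b hb hab
      · rw [φf, φf]
        exact ((hD _ _).1 hab).reachable
    have h : ∀ y ∈ Q ∪ Set.range g, B.Reachable q₀ y := by
      rintro y (hy | ⟨d, rfl⟩)
      · exact hQr _ hq₀ _ hy
      · have := (hA.reachable p₀ (Or.inl hp₀) (f d) (Or.inr ⟨d, rfl⟩)).lift_of_adj φ hmap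
        rwa [φf, φP _ hp₀] at this
    exact fun a ha b hb => (h a ha).symm.trans (h b hb)

lemma isTreeOn_univ_iff {X : Type*} [Nonempty X] {A : SimpleGraph X} :
    A.IsTreeOn Set.univ ↔ A.IsTree :=
  ⟨fun h => ⟨⟨fun a b => h.reachable a trivial b trivial⟩, h.isAcyclic⟩,
    fun h => ⟨fun _ _ _ => trivial, h.isAcyclic, fun a _ b _ => h.connected.preconnected a b⟩⟩

lemma IsTree.isTreeOn_map {N Y : Type*} {H : SimpleGraph N} (hH : H.IsTree) (f : N ↪ Y) :
    (H.map f).IsTreeOn (Set.range f) := by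
  refine ⟨?_, ?_, ?_⟩
  · rintro _ _ ⟨-, a, b, _, rfl, rfl⟩
    exact ⟨a, rfl⟩
  · rw [isAcyclic_iff_forall_adj_isBridge]
    rintro _ _ ⟨-, a, b, hab, rfl, rfl⟩
    rw [isBridge_iff]
    intro hr
    have := hr.lift_of_adj (B := H.deleteEdges {s(a, b)}) (Function.extend f id fun _ => a) (by
      rintro x y h
      obtain ⟨⟨-, a', b', hab', rfl, rfl⟩, hne⟩ := deleteEdges_adj.1 h
      rw [f.injective.extend_apply, f.injective.extend_apply]
      refine Adj.reachable (deleteEdges_adj.2 ⟨hab', fun he => hne ?_⟩)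
      rcases Sym2.eq_iff.1 he with ⟨h1, h2⟩ | ⟨h1, h2⟩
      · simp only [id] at h1 h2
        rw [h1, h2]; rfl
      · simp only [id] at h1 h2
        rw [h1, h2, Sym2.eq_swap]; rfl)
    rw [f.injective.extend_apply, f.injective.extend_apply] at this
    exact hH.isAcyclic.not_reachable_of_adj hab this
  · rintro _ ⟨a, rfl⟩ _ ⟨b, rfl⟩
    refine (hH.connected.preconnected a b).lift_of_adj f fun x y h => Adj.reachable ?_
    rwa [map_adj_apply]

/-- Replace the vertices in `W` by the graph `H` and restrict to `U`: an edge from `d ∈ U \ W` to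
`w ∈ W` becomes an edge from `d` to `φ d w`. -/
def replace {V N : Type*} (A : SimpleGraph V) (W U : Set V) (φ : V → V → N) (H : SimpleGraph N) :
    SimpleGraph (N ⊕ ↥(U \ W)) where
  Adj
    | .inl m, .inl n => H.Adj m n
    | .inr d, .inr e => A.Adj d e
    | .inr d, .inl n => ∃ w ∈ W, A.Adj d w ∧ φ d w = n
    | .inl n, .inr d => ∃ w ∈ W, A.Adj d w ∧ φ d w = n
  symm := ⟨by
    rintro (m | d) (n | e) h
    · exact h.symm
    · exact h
    · exact h
    · exact h.symm⟩
  loopless := ⟨by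
    rintro (m | d) h
    · exact H.loopless.irrefl _ h
    · exact A.loopless.irrefl _ h⟩

lemma union_range_val_diff {V : Type*} {W U : Set V} (h : W ⊆ U) :
    W ∪ Set.range (Subtype.val : ↥(U \ W) → V) = U := by
  rw [Subtype.range_coe]
  exact Set.union_sdiff_cancel h

lemma isTree_replace {V N : Type*} [Nonempty N] {A : SimpleGraph V} (hA : A.IsAcyclic)
    {W U : Set V} (hWU : W ⊆ U) (hW : W.Nonempty)
    (hAW : ∀ a ∈ W, ∀ b ∈ W, (A.within W).Reachable a b)
    (hAU : ∀ a ∈ U, ∀ b ∈ U, (A.within U).Reachable a b) (φ : V → V → N)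
    {H : SimpleGraph N} (hH : H.IsTree) : (A.replace W U φ H).IsTree := by
  rw [← isTreeOn_univ_iff, ← Set.range_inl_union_range_inr]
  obtain ⟨r, hr⟩ := hW
  have hWW : (A.within U).within W = A.within W := by
    ext a b
    exact ⟨fun h => ⟨h.1.1, h.2⟩, fun h => ⟨⟨h.1, hWU h.2.1, hWU h.2.2⟩, h.2⟩⟩
  refine IsTreeOn.transfer (A := A.within U) (P := W) (f := Subtype.val) (p₀ := r)
    (q₀ := Sum.inl (Classical.arbitrary N)) Subtype.val_injective
    Sum.inr_injective (fun d => d.2.2) (by simp) hr ⟨_, rfl⟩ ?_ ?_ ?_ ?_ ?_ ?_ ?_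
  · rw [union_range_val_diff hWU]
    exact ⟨fun a b h => h.2.1, hA.anti (within_le _ _), hAU⟩
  · rwa [hWW]
  · intro a b _
    rw [Set.range_inl_union_range_inr]
    trivial
  · convert hH.isTreeOn_map (Function.Embedding.inl (β := ↥(U \ W))) using 1
    swap
    · rfl
    ext a b
    rw [map_adj]
    constructor
    · rintro ⟨h, ⟨m, rfl⟩, ⟨n, rfl⟩⟩
      exact ⟨m, n, h, rfl, rfl⟩
    · rintro ⟨m, n, h, rfl, rfl⟩
      exact ⟨h, ⟨m, rfl⟩, ⟨n, rfl⟩⟩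
  · exact fun d e => ⟨fun h => h.1, fun h => ⟨h, d.2.1, e.2.1⟩⟩
  · intro d
    constructor
    · rintro ⟨w, hw, h⟩
      exact ⟨_, ⟨φ d w, rfl⟩, w, hw, h.1, rfl⟩
    · rintro ⟨_, ⟨n, rfl⟩, w, hw, h, -⟩
      exact ⟨w, hw, h, d.2.1, hWU hw⟩
  · rintro d _ ⟨m, rfl⟩ _ ⟨n, rfl⟩ ⟨w, hw, h, rfl⟩ ⟨w', hw', h', rfl⟩
    rw [hA.eq_of_adj_of_adj hAW d.2.2 hw hw' h h']

/-- The inverse operation of `replace`: the union of a graph `R` on `W` and those edges of `G` that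
correspond to an edge of `C`. -/
def glue {V N : Type*} (G R : SimpleGraph V) (W U : Set V) (φ : V → V → N)
    (C : SimpleGraph (N ⊕ ↥(U \ W))) : SimpleGraph V where
  Adj a b := R.Adj a b ∨ (∃ d e : ↥(U \ W), a = d ∧ b = e ∧ C.Adj (.inr d) (.inr e)) ∨
    (∃ d : ↥(U \ W), a = d ∧ b ∈ W ∧ G.Adj d b ∧ C.Adj (.inr d) (.inl (φ d b))) ∨
    (∃ d : ↥(U \ W), b = d ∧ a ∈ W ∧ G.Adj d a ∧ C.Adj (.inr d) (.inl (φ d a)))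
  symm := ⟨by
    rintro a b (h | ⟨d, e, rfl, rfl, h⟩ | h | h)
    · exact Or.inl h.symm
    · exact Or.inr (Or.inl ⟨e, d, rfl, rfl, h.symm⟩)
    · exact Or.inr (Or.inr (Or.inr h))
    · exact Or.inr (Or.inr (Or.inl h))⟩
  loopless := ⟨by
    rintro a (h | ⟨d, e, rfl, h, h'⟩ | ⟨d, rfl, -, h, -⟩ | ⟨d, rfl, -, h, -⟩)
    · exact h.ne rfl
    · exact h'.ne (by rw [Subtype.ext h])
    · exact h.ne rfl
    · exact h.ne rfl⟩

section glue

variable {V N : Type*} {G R : SimpleGraph V} {W U : Set V} {φ : V → V → N}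
  {C : SimpleGraph (N ⊕ ↥(U \ W))}

lemma glue_adj_of_mem {a b : V} (ha : a ∈ W) (hb : b ∈ W) :
    (glue G R W U φ C).Adj a b ↔ R.Adj a b := by
  refine ⟨?_, Or.inl⟩
  rintro (h | ⟨d, e, rfl, rfl, h⟩ | ⟨d, rfl, -⟩ | ⟨d, rfl, -⟩)
  · exact h
  · exact absurd ha d.2.2
  · exact absurd ha d.2.2
  · exact absurd hb d.2.2

lemma glue_adj_val (hR : ∀ a b, R.Adj a b → a ∈ W) (d e : ↥(U \ W)) :
    (glue G R W U φ C).Adj d e ↔ C.Adj (.inr d) (.inr e) := by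
  refine ⟨?_, fun h => Or.inr (Or.inl ⟨d, e, rfl, rfl, h⟩)⟩
  rintro (h | ⟨d', e', hd, he, h⟩ | ⟨d', -, h, -⟩ | ⟨d', -, h, -⟩)
  · exact absurd (hR _ _ h) d.2.2
  · rwa [Subtype.ext hd, Subtype.ext he]
  · exact absurd h e.2.2
  · exact absurd h d.2.2

lemma glue_adj_val_of_mem (hR : ∀ a b, R.Adj a b → a ∈ W) (d : ↥(U \ W)) {w : V} (hw : w ∈ W) :
    (glue G R W U φ C).Adj d w ↔ G.Adj d w ∧ C.Adj (.inr d) (.inl (φ d w)) := by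
  refine ⟨?_, fun h => Or.inr (Or.inr (Or.inl ⟨d, rfl, hw, h⟩))⟩
  rintro (h | ⟨d', e', -, rfl, h⟩ | ⟨d', hd, h, h'⟩ | ⟨d', -, h, -⟩)
  · exact absurd (hR _ _ h) d.2.2
  · exact absurd hw e'.2.2
  · rwa [Subtype.ext hd]
  · exact absurd h d.2.2

lemma glue_mem_of_adj (hWU : W ⊆ U) (hR : ∀ a b, R.Adj a b → a ∈ W) {a b : V}
    (h : (glue G R W U φ C).Adj a b) : a ∈ U := by
  obtain h | ⟨d, e, rfl, rfl, h⟩ | ⟨d, rfl, h⟩ | ⟨d, rfl, h⟩ := h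
  · exact hWU (hR _ _ h)
  · exact d.2.1
  · exact d.2.1
  · exact hWU h.1

lemma isTreeOn_glue {H : SimpleGraph N} [Nonempty N] (hWU : W ⊆ U) (hW : W.Nonempty)
    (hR : R.IsTreeOn W) (hC : C.IsTree) (hCG : C ≤ G.replace W U φ H)
    (hφ : ∀ d ∉ W, ∀ w ∈ W, ∀ w' ∈ W, G.Adj d w → G.Adj d w' → φ d w = φ d w' → w = w')
    (hCN : (C.comap Sum.inl).Connected) : (glue G R W U φ C).IsTreeOn U := by
  obtain ⟨r, hr⟩ := hW
  have hCr : ∀ p ∈ Set.range (Sum.inl : N → N ⊕ ↥(U \ W)), ∀ q ∈ Set.range Sum.inl,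
      (C.within (Set.range Sum.inl)).Reachable p q := by
    rintro _ ⟨m, rfl⟩ _ ⟨n, rfl⟩
    refine (hCN.preconnected m n).lift_of_adj Sum.inl fun x y h => Adj.reachable ?_
    exact ⟨h, ⟨x, rfl⟩, ⟨y, rfl⟩⟩
  have key := IsTreeOn.transfer (A := C) (B := glue G R W U φ C) (P := Set.range Sum.inl) (Q := W)
    (f := Sum.inr) (g := Subtype.val) (p₀ := Sum.inl (Classical.arbitrary N)) (q₀ := r)
    Sum.inr_injective Subtype.val_injective (by simp) (fun d => d.2.2) ⟨_, rfl⟩ hr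
    (by rw [Set.range_inl_union_range_inr, isTreeOn_univ_iff]; exact hC) hCr
    (by
      intro a b h
      rw [union_range_val_diff hWU]
      exact glue_mem_of_adj hWU hR.mem_of_adj h)
    (by
      convert hR
      ext a b
      refine ⟨fun h => (glue_adj_of_mem h.2.1 h.2.2).1 h.1, fun h => ?_⟩
      exact ⟨Or.inl h, hR.mem_of_adj _ _ h, hR.mem_of_adj _ _ h.symm⟩)
    (fun d e => (glue_adj_val hR.mem_of_adj d e).symm)
    (by
      intro d
      constructor
      · rintro ⟨_, ⟨n, rfl⟩, h⟩
        obtain ⟨w, hw, hadj, rfl⟩ := hCG h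
        exact ⟨w, hw, (glue_adj_val_of_mem hR.mem_of_adj d hw).2 ⟨hadj, h⟩⟩
      · rintro ⟨w, hw, h⟩
        exact ⟨_, ⟨_, rfl⟩, ((glue_adj_val_of_mem hR.mem_of_adj d hw).1 h).2⟩)
    (by
      intro d w hw w' hw' h h'
      rw [glue_adj_val_of_mem hR.mem_of_adj d hw] at h
      rw [glue_adj_val_of_mem hR.mem_of_adj d hw'] at h'
      exact hφ d d.2.2 w hw w' hw' h.1 h'.1 (Sum.inl_injective
        (hC.isAcyclic.eq_of_adj_of_adj hCr (by simp) ⟨_, rfl⟩ ⟨_, rfl⟩ h.2 h'.2)))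
  rwa [union_range_val_diff hWU] at key

end glue

/-- The graphs `R i` decompose the subgraph of `G` induced on `U` into spanning trees. -/
structure IsDecompositionOn {V : Type*} {k : ℕ} (G : SimpleGraph V) (U : Set V)
    (R : Fin k → SimpleGraph V) : Prop where
  le : ∀ i, R i ≤ G
  isTreeOn : ∀ i, (R i).IsTreeOn U
  disjoint : ∀ i j a b, (R i).Adj a b → (R j).Adj a b → i = j
  cover : ∀ a ∈ U, ∀ b ∈ U, G.Adj a b → ∃ i, (R i).Adj a b

lemma disjoint_edgeSet_iff_forall_adj {V : Type*} {A B : SimpleGraph V} :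
    Disjoint A.edgeSet B.edgeSet ↔ ∀ a b, A.Adj a b → ¬ B.Adj a b := by
  rw [Set.disjoint_left]
  exact ⟨fun h a b => @h s(a, b), fun h e => by induction e with | h a b => exact h a b⟩

lemma pairwise_disjoint_edgeSet_iff {V ι : Type*} {R : ι → SimpleGraph V} :
    (Pairwise fun i j => Disjoint (R i).edgeSet (R j).edgeSet) ↔
      ∀ i j a b, (R i).Adj a b → (R j).Adj a b → i = j := by
  simp only [disjoint_edgeSet_iff_forall_adj]
  exact ⟨fun h i j a b h1 h2 => by_contra fun hij => h hij a b h1 h2,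
    fun h i j hij a b h1 h2 => hij (h i j a b h1 h2)⟩

lemma iUnion_edgeSet_eq_iff {V ι : Type*} {R : ι → SimpleGraph V} {G : SimpleGraph V}
    (hR : ∀ i, R i ≤ G) :
    (⋃ i, (R i).edgeSet) = G.edgeSet ↔ ∀ a b, G.Adj a b → ∃ i, (R i).Adj a b := by
  constructor
  · intro h a b hab
    have : s(a, b) ∈ ⋃ i, (R i).edgeSet := h ▸ hab
    simpa using this
  · intro h
    refine Set.Subset.antisymm (Set.iUnion_subset fun i => edgeSet_mono (hR i)) fun e => ?_
    induction e with | h a b => simpa using h a b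

lemma IsDecompositionOn.exists_extension {V : Type u} {k : ℕ} (hk : 1 ≤ k)
    (hcount : ∀ (V : Type u), Countable V → ∀ G : SimpleGraph V,
      HasPackingN G k → HasCoveringN G k → HasDecompositionN G k)
    {G : SimpleGraph V} {T S : Fin k → SimpleGraph V}
    (hTG : ∀ i, T i ≤ G) (hT : ∀ i, (T i).IsAcyclic)
    (hTd : ∀ i j a b, (T i).Adj a b → (T j).Adj a b → i = j)
    (hSG : ∀ i, S i ≤ G) (hS : ∀ i, (S i).IsAcyclic)
    (hSc : ∀ a b, G.Adj a b → ∃ i, (S i).Adj a b)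
    {W U : Set V} (hWU : W ⊆ U) (hW : W.Nonempty) (hUW : (U \ W).Countable)
    (hTW : ∀ i, ∀ a ∈ W, ∀ b ∈ W, ((T i).within W).Reachable a b)
    (hTU : ∀ i, ∀ a ∈ U, ∀ b ∈ U, ((T i).within U).Reachable a b)
    (hSW : ∀ i, ∀ a ∈ W, ∀ b ∈ W, ((S i).within W).Reachable a b)
    (hSU : ∀ i, ∀ a ∈ U, ∀ b ∈ U, ((S i).within U).Reachable a b)
    {R : Fin k → SimpleGraph V} (hR : G.IsDecompositionOn W R) :
    ∃ R' : Fin k → SimpleGraph V, (∀ i, R i ≤ R' i) ∧ G.IsDecompositionOn U R' := by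
  have : Countable ↥(U \ W) := hUW.to_subtype
  have : Nonempty (Fin k) := ⟨⟨0, hk⟩⟩
  have hcol : ∀ d w, ∃ i, G.Adj d w → (S i).Adj d w := by
    intro d w
    by_cases h : G.Adj d w
    · exact (hSc d w h).imp fun i hi _ => hi
    · exact ⟨Classical.arbitrary _, fun h' => absurd h' h⟩
  choose c hc using hcol
  let φ : V → V → Fin k × Bool := fun d w => (c d w, true)
  have hφ : ∀ d ∉ W, ∀ w ∈ W, ∀ w' ∈ W, G.Adj d w → G.Adj d w' → φ d w = φ d w' → w = w' := by
    intro d hd w hw w' hw' h h' he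
    have he' : c d w = c d w' := congrArg Prod.fst he
    exact (hS _).eq_of_adj_of_adj (hSW _) hd hw hw' (hc d w h) (he' ▸ hc d w' h')
  have hle : ∀ {A : SimpleGraph V} {H : SimpleGraph (Fin k × Bool)}, A ≤ G →
      A.replace W U φ H ≤ G.replace W U φ ⊤ := by
    rintro A H hA (m | d) (n | e) h
    · exact Adj.ne (G := H) h
    · obtain ⟨w, hw, h, h'⟩ := h
      exact ⟨w, hw, hA h, h'⟩
    · obtain ⟨w, hw, h, h'⟩ := h
      exact ⟨w, hw, hA h, h'⟩
    · exact hA h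
  have hpack : HasPackingN (G.replace W U φ ⊤) k := by
    refine ⟨fun i => (T i).replace W U φ (doubleStar i), fun i => ⟨hle (hTG i),
      isTree_replace (hT i) hWU hW (hTW i) (hTU i) φ (doubleStar_isTree i)⟩,
      pairwise_disjoint_edgeSet_iff.2 ?_⟩
    have hdn : ∀ i j (d : ↥(U \ W)) n, (∃ w ∈ W, (T i).Adj d w ∧ φ d w = n) →
        (∃ w ∈ W, (T j).Adj d w ∧ φ d w = n) → i = j := by
      rintro i j d n ⟨w, hw, h, he⟩ ⟨w', hw', h', he'⟩
      obtain rfl := hφ d d.2.2 w hw w' hw' (hTG i h) (hTG j h') (he.trans he'.symm)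
      exact hTd i j _ _ h h'
    rintro i j (m | d) (n | e) h h'
    · exact h.2.symm.trans h'.2
    · exact hdn i j e m h h'
    · exact hdn i j d n h h'
    · exact hTd i j _ _ h h'
  have hcov : HasCoveringN (G.replace W U φ ⊤) k := by
    refine ⟨fun i => (S i).replace W U φ (doubleStar i), fun i => ⟨hle (hSG i),
      isTree_replace (hS i) hWU hW (hSW i) (hSU i) φ (doubleStar_isTree i)⟩,
      (iUnion_edgeSet_eq_iff fun i => hle (hSG i)).2 ?_⟩
    rintro (m | d) (n | e) h
    · exact ⟨_, h, rfl⟩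
    · obtain ⟨w, hw, h, h'⟩ := h
      exact ⟨c e w, w, hw, hc _ _ h, h'⟩
    · obtain ⟨w, hw, h, h'⟩ := h
      exact ⟨c d w, w, hw, hc _ _ h, h'⟩
    · exact hSc _ _ h
  obtain ⟨C, hC, hCd, hCc⟩ := hcount _ inferInstance _ hpack hcov
  rw [pairwise_disjoint_edgeSet_iff] at hCd
  rw [iUnion_edgeSet_eq_iff fun i => (hC i).1] at hCc
  have hCN := connected_of_isAcyclic_of_cover_top hk (by simp [mul_comm])
    (fun i => (C i).comap (Sum.inl : Fin k × Bool → _))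
    (fun i => (hC i).2.isAcyclic.of_comap Function.Embedding.inl)
    (fun a b hab => hCc (.inl a) (.inl b) hab)
  have hRm := fun i => (hR.isTreeOn i).mem_of_adj
  refine ⟨fun i => glue G (R i) W U φ (C i), fun i a b h => Or.inl h, ⟨?_, ?_, ?_, ?_⟩⟩
  · rintro i a b (h | ⟨d, e, rfl, rfl, h⟩ | ⟨d, rfl, -, h, -⟩ | ⟨d, rfl, -, h, -⟩)
    · exact hR.le i h
    · exact (hC i).1 h
    · exact h
    · exact h.symm
  · exact fun i => isTreeOn_glue hWU hW (hR.isTreeOn i) (hC i).2 (hC i).1 hφ (hCN i)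
  · have hdw : ∀ i j (d : ↥(U \ W)), ∀ w ∈ W, (glue G (R i) W U φ (C i)).Adj d w →
        (glue G (R j) W U φ (C j)).Adj d w → i = j := by
      intro i j d w hw h h'
      rw [glue_adj_val_of_mem (hRm _) d hw] at h h'
      exact hCd i j _ _ h.2 h'.2
    intro i j a b h h'
    have ha := glue_mem_of_adj hWU (hRm i) h
    have hb := glue_mem_of_adj hWU (hRm i) h.symm
    by_cases haW : a ∈ W <;> by_cases hbW : b ∈ W
    · rw [glue_adj_of_mem haW hbW] at h h'
      exact hR.disjoint i j a b h h'
    · exact hdw i j ⟨b, hb, hbW⟩ a haW h.symm h'.symm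
    · exact hdw i j ⟨a, ha, haW⟩ b hbW h h'
    · exact hCd i j _ _ ((glue_adj_val (hRm i) ⟨a, ha, haW⟩ ⟨b, hb, hbW⟩).1 h)
        ((glue_adj_val (hRm j) ⟨a, ha, haW⟩ ⟨b, hb, hbW⟩).1 h')
  · have hdw : ∀ (d : ↥(U \ W)), ∀ w ∈ W, G.Adj d w →
        ∃ i, (glue G (R i) W U φ (C i)).Adj d w := by
      intro d w hw h
      obtain ⟨i, hi⟩ := hCc (.inr d) (.inl (φ d w)) ⟨w, hw, h, rfl⟩
      exact ⟨i, (glue_adj_val_of_mem (hRm i) d hw).2 ⟨h, hi⟩⟩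
    intro a ha b hb h
    by_cases haW : a ∈ W <;> by_cases hbW : b ∈ W
    · exact (hR.cover a haW b hbW h).imp fun i hi => Or.inl hi
    · exact (hdw ⟨b, hb, hbW⟩ a haW h.symm).imp fun i hi => hi.symm
    · exact hdw ⟨a, ha, haW⟩ b hbW h
    · obtain ⟨i, hi⟩ := hCc (.inr ⟨a, ha, haW⟩) (.inr ⟨b, hb, hbW⟩) h
      exact ⟨i, (glue_adj_val (hRm i) ⟨a, ha, haW⟩ ⟨b, hb, hbW⟩).2 hi⟩

/-- The union of a chain of decompositions is a decomposition. -/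
lemma isDecompositionOn_of_isChain {V : Type*} {k : ℕ} {G : SimpleGraph V}
    {c : Set (Set V × (Fin k → SimpleGraph V))} (hc : IsChain (· ≤ ·) c)
    (h : ∀ x ∈ c, G.IsDecompositionOn x.1 x.2) :
    G.IsDecompositionOn (⋃ x ∈ c, x.1) fun i => sSup ((fun x => x.2 i) '' c) := by
  have hadj : ∀ {i : Fin k} {a b : V},
      (sSup ((fun x : Set V × (Fin k → SimpleGraph V) => x.2 i) '' c)).Adj a b ↔
        ∃ x ∈ c, (x.2 i).Adj a b := by
    intro i a b
    simp
  have hdir : ∀ x ∈ c, ∀ y ∈ c, ∃ z ∈ c, x ≤ z ∧ y ≤ z := hc.directedOn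
  refine ⟨fun i => ?_, fun i => ⟨?_, ?_, ?_⟩, ?_, ?_⟩
  · rintro a b hab
    obtain ⟨x, hx, hab⟩ := hadj.1 hab
    exact (h x hx).le i hab
  · rintro a b hab
    obtain ⟨x, hx, hab⟩ := hadj.1 hab
    exact Set.mem_biUnion hx (((h x hx).isTreeOn i).mem_of_adj a b hab)
  · apply isAcyclic_sSup_of_isAcyclic_directedOn
    · rintro _ ⟨x, hx, rfl⟩
      exact ((h x hx).isTreeOn i).isAcyclic
    · rintro _ ⟨x, hx, rfl⟩ _ ⟨y, hy, rfl⟩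
      obtain ⟨z, hz, hxz, hyz⟩ := hdir x hx y hy
      exact ⟨_, ⟨z, hz, rfl⟩, hxz.2 i, hyz.2 i⟩
  · intro a ha b hb
    obtain ⟨x, hx, ha⟩ := Set.mem_iUnion₂.1 ha
    obtain ⟨y, hy, hb⟩ := Set.mem_iUnion₂.1 hb
    obtain ⟨z, hz, hxz, hyz⟩ := hdir x hx y hy
    exact (((h z hz).isTreeOn i).reachable a (hxz.1 ha) b (hyz.1 hb)).mono
      fun _ _ h => hadj.2 ⟨z, hz, h⟩
  · intro i j a b hi hj
    obtain ⟨x, hx, ha⟩ := hadj.1 hi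
    obtain ⟨y, hy, hb⟩ := hadj.1 hj
    obtain ⟨z, hz, hxz, hyz⟩ := hdir x hx y hy
    exact (h z hz).disjoint i j a b (hxz.2 i ha) (hyz.2 j hb)
  · intro a ha b hb hab
    obtain ⟨x, hx, ha⟩ := Set.mem_iUnion₂.1 ha
    obtain ⟨y, hy, hb⟩ := Set.mem_iUnion₂.1 hb
    obtain ⟨z, hz, hxz, hyz⟩ := hdir x hx y hy
    obtain ⟨i, hi⟩ := (h z hz).cover a (hxz.1 ha) b (hyz.1 hb) hab
    exact ⟨i, hadj.2 ⟨z, hz, hi⟩⟩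

lemma Walk.reachable_within {V : Type*} {A : SimpleGraph V} {W : Set V} {a b : V}
    (w : A.Walk a b) (hw : ∀ x ∈ w.support, x ∈ W) : (A.within W).Reachable a b := by
  induction w with
  | nil => rfl
  | cons h p ih =>
    have hp : ∀ x ∈ p.support, x ∈ W := fun x hx => hw x (by simp [hx])
    have hadj : (A.within W).Adj _ _ := ⟨h, hw _ (by simp), hp _ p.start_mem_support⟩
    exact hadj.reachable.trans (ih hp)

/-- For countably many connected graphs on `V`, a countably branching set-valued map such that
every set containing `r` and closed under this map is connected in each of the graphs. -/
lemma exists_closure_map {V J : Type*} [Countable J] (Q : J → SimpleGraph V)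
    (hQ : ∀ j, (Q j).Connected) (r : V) :
    ∃ f : V → Set V, (∀ x, (f x).Countable) ∧ f r ⊆ {r} ∧
      ∀ W : Set V, r ∈ W → (∀ x ∈ W, f x ⊆ W) →
        ∀ j, ∀ a ∈ W, ∀ b ∈ W, ((Q j).within W).Reachable a b := by
  choose p hp using fun j x => ((hQ j).preconnected r x).exists_isPath
  refine ⟨fun x => ⋃ j, {y | y ∈ (p j x).support}, fun x => ?_, ?_, ?_⟩
  · exact Set.countable_iUnion fun j => (List.finite_toSet _).countable
  · refine Set.iUnion_subset fun j y hy => ?_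
    have hnil : p j r = Walk.nil := (Walk.isPath_iff_nil.1 (hp j r)).eq_nil
    simpa [hnil] using hy
  · intro W hr hW j
    have h : ∀ a ∈ W, ((Q j).within W).Reachable r a := fun a ha =>
      (p j a).reachable_within fun x hx => hW a ha (Set.mem_iUnion.2 ⟨j, hx⟩)
    exact fun a ha b hb => (h a ha).symm.trans (h b hb)

end SimpleGraph

lemma Set.exists_countable_closed {V : Type*} {f : V → Set V} (hf : ∀ x, (f x).Countable) (x : V) :
    ∃ C : Set V, x ∈ C ∧ C.Countable ∧ ∀ y ∈ C, f y ⊆ C := by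
  let A : ℕ → Set V := fun n => Nat.rec {x} (fun _ s => ⋃ y ∈ s, f y) n
  have hA : ∀ n, (A n).Countable := by
    intro n
    induction n with
    | zero => exact Set.countable_singleton x
    | succ n ih => exact ih.biUnion fun y _ => hf y
  refine ⟨⋃ n, A n, Set.mem_iUnion.2 ⟨0, rfl⟩, Set.countable_iUnion hA, fun y hy z hz => ?_⟩
  obtain ⟨n, hn⟩ := Set.mem_iUnion.1 hy
  exact Set.mem_iUnion.2 ⟨n + 1, Set.mem_biUnion hn hz⟩

/-- Fix k ≥ 1. If every countable graph with a k-packing and a k-covering admits a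
k-decomposition, then every graph with a k-packing and a k-covering admits a
k-decomposition. -/
theorem decompositionN_of_countable_case (k : ℕ) (hk : 1 ≤ k)
    (hcount : ∀ (V : Type u), Countable V → ∀ G : SimpleGraph V,
      HasPackingN G k → HasCoveringN G k → HasDecompositionN G k) :
    ∀ (V : Type u) (G : SimpleGraph V),
      HasPackingN G k → HasCoveringN G k → HasDecompositionN G k := by
  intro V G ⟨T, hT, hTd⟩ ⟨S, hS, hSc⟩
  rw [SimpleGraph.pairwise_disjoint_edgeSet_iff] at hTd
  rw [SimpleGraph.iUnion_edgeSet_eq_iff fun i => (hS i).1] at hSc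
  obtain ⟨r⟩ := (hT ⟨0, hk⟩).2.connected.nonempty
  obtain ⟨f, hf, hfr, hconn⟩ := SimpleGraph.exists_closure_map (Sum.elim T S)
    (by rintro (i | i); exacts [(hT i).2.connected, (hS i).2.connected]) r
  have hzorn := zorn_le_nonempty₀
    {x : Set V × (Fin k → SimpleGraph V) |
      r ∈ x.1 ∧ (∀ v ∈ x.1, f v ⊆ x.1) ∧ G.IsDecompositionOn x.1 x.2}
    (fun c hcs hc y hy => ⟨(⋃ x ∈ c, x.1, fun i => sSup ((fun x => x.2 i) '' c)),
      ⟨Set.mem_biUnion hy (hcs hy).1, fun v hv => by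
        obtain ⟨x, hx, hv⟩ := Set.mem_iUnion₂.1 hv
        exact ((hcs hx).2.1 v hv).trans (Set.subset_biUnion_of_mem (u := Prod.fst) hx),
      SimpleGraph.isDecompositionOn_of_isChain hc fun x hx => (hcs hx).2.2⟩,
      fun z hz => ⟨Set.subset_biUnion_of_mem (u := Prod.fst) hz,
        fun i => le_sSup ⟨z, hz, rfl⟩⟩⟩)
    ({r}, fun _ => ⊥)
    ⟨rfl, by rintro v rfl; exact hfr, fun _ => bot_le,
      fun _ => ⟨fun _ _ h => h.elim, SimpleGraph.isAcyclic_bot, by rintro a rfl b rfl; rfl⟩,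
      fun _ _ _ _ h => h.elim, by rintro a rfl b rfl h; exact absurd rfl h.ne⟩
  obtain ⟨⟨W, R⟩, -, ⟨hrW, hfW, hR⟩, hmax⟩ := hzorn
  have hWuniv : W = Set.univ := by
    rw [Set.eq_univ_iff_forall]
    intro v
    obtain ⟨C, hvC, hC, hfC⟩ := Set.exists_countable_closed hf v
    have hfU : ∀ x ∈ W ∪ C, f x ⊆ W ∪ C := by
      rintro x (hx | hx)
      · exact (hfW x hx).trans Set.subset_union_left
      · exact (hfC x hx).trans Set.subset_union_right
    have hconnU := hconn (W ∪ C) (Or.inl hrW) hfU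
    obtain ⟨R', hRR', hR'⟩ := hR.exists_extension hk hcount
      (fun i => (hT i).1) (fun i => (hT i).2.isAcyclic) hTd
      (fun i => (hS i).1) (fun i => (hS i).2.isAcyclic) hSc
      Set.subset_union_left ⟨r, hrW⟩ (hC.mono fun x hx => hx.1.resolve_left hx.2)
      (fun i => hconn W hrW hfW (.inl i)) (fun i => hconnU (.inl i))
      (fun i => hconn W hrW hfW (.inr i)) (fun i => hconnU (.inr i))
    exact (hmax (y := (W ∪ C, R')) ⟨Or.inl hrW, hfU, hR'⟩
      ⟨Set.subset_union_left, hRR'⟩).1 (Or.inr hvC)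
  subst hWuniv
  have : Nonempty V := ⟨r⟩
  exact ⟨R, fun i => ⟨hR.le i, SimpleGraph.isTreeOn_univ_iff.1 (hR.isTreeOn i)⟩,
    SimpleGraph.pairwise_disjoint_edgeSet_iff.2 hR.disjoint,
    (SimpleGraph.iUnion_edgeSet_eq_iff hR.le).2 fun a b => hR.cover a trivial b trivial⟩
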